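/- Let A be a real n×n matrix, B a real n×m matrix, and for each time index τ let Z_τ ⊆ ℝ^n and V_τ ⊆ ℝ^m be constraint sets. Suppose there exist a terminal set Z_f and a map π : Z_f → ℝ^m such that Z_f ⊆ Z_τ and π(z) ∈ V_τ for every τ and every z ∈ Z_f, and A z + B π(z) ∈ Z_f for every z ∈ Z_f (positive invariance). If (z_0, ..., z_N) and (v_0, ..., v_{N-1}) satisfy z_{i+1} = A z_i + B v_i, z_i ∈ Z_{t+i} for i = 0, ..., N−1, v_i ∈ V_{t+i} for i = 0, ..., N−1, and z_N ∈ Z_f, then the shifted sequences z'_i := z_{i+1} for i = 0, ..., N−1 with z'_N := A z_N + B π(z_N), and v'_i := v_{i+1} for i = 0, ..., N−2 with v'_{N−1} := π(z_N), satisfy z'_{i+1} = A z'_i + B v'_i, z'_i ∈ Z_{(t+1)+i} for i = 0, ..., N−1, v'_i ∈ V_{(t+1)+i} for i = 0, ..., N−1, and z'_N ∈ Z_f. -/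

import Mathlib

open Matrix

/-- Shifted-candidate-sequence argument for recursive feasibility: given a
terminal set `Zf` contained in all state constraint sets, a terminal control
law `π` whose values on `Zf` lie in all input constraint sets and which renders
`Zf` positively invariant, any feasible nominal state-input sequence at time
`t` yields, after shifting and appending the terminal controller, a feasible
sequence at time `t + 1`. -/
theorem shifted_sequence_recursive_feasibility
    (n m N t : ℕ)
    (A : Matrix (Fin n) (Fin n) ℝ) (B : Matrix (Fin n) (Fin m) ℝ)
    (Z : ℕ → Set (Fin n → ℝ)) (V : ℕ → Set (Fin m → ℝ))
    (Zf : Set (Fin n → ℝ)) (π : (Fin n → ℝ) → (Fin m → ℝ))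
    (hZf : ∀ τ, Zf ⊆ Z τ)
    (hπV : ∀ τ, ∀ zz ∈ Zf, π zz ∈ V τ)
    (hinv : ∀ zz ∈ Zf, A.mulVec zz + B.mulVec (π zz) ∈ Zf)
    (z : ℕ → Fin n → ℝ) (v : ℕ → Fin m → ℝ)
    (hdyn : ∀ i < N, z (i + 1) = A.mulVec (z i) + B.mulVec (v i))
    (hzcon : ∀ i < N, z i ∈ Z (t + i))
    (hvcon : ∀ i < N, v i ∈ V (t + i))
    (hterm : z N ∈ Zf)
    (z' : ℕ → Fin n → ℝ) (v' : ℕ → Fin m → ℝ)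
    (hz' : ∀ i, z' i = if i = N then A.mulVec (z N) + B.mulVec (π (z N)) else z (i + 1))
    (hv' : ∀ i, v' i = if i = N - 1 then π (z N) else v (i + 1)) :
    (∀ i < N, z' (i + 1) = A.mulVec (z' i) + B.mulVec (v' i)) ∧
      (∀ i < N, z' i ∈ Z (t + 1 + i)) ∧
      (∀ i < N, v' i ∈ V (t + 1 + i)) ∧
      z' N ∈ Zf := by
  have shift_index (i : ℕ) : t + 1 + i = t + (i + 1) := by omega
  refine ⟨fun i hi => ?_, fun i hi => ?_, fun i hi => ?_, ?_⟩
  · rw [hz' (i + 1), hz' i, hv' i, if_neg hi.ne]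
    rcases (Nat.succ_le_of_lt hi).eq_or_lt with rfl | h
    · simp
    · rw [if_neg h.ne, if_neg (by omega)]
      exact hdyn (i + 1) h
  · rw [hz' i, if_neg hi.ne]
    rcases (Nat.succ_le_of_lt hi).eq_or_lt with rfl | h
    · exact hZf _ hterm
    · rw [shift_index]
      exact hzcon (i + 1) h
  · rw [hv' i]
    split_ifs with h
    · exact hπV _ _ hterm
    · rw [shift_index]
      exact hvcon (i + 1) (by omega)
  · rw [hz' N, if_pos rfl]
    exact hinv _ hterm
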